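/- arXiv:2410.24027 — 5 statements merged into one kernel-verified Lean document; each statement's English description precedes it below -/
import Mathlib

section
/- Let F be a field, m a natural number, and i ∈ F with i^2 = -1. Let A, B : Matrix (Fin m) (Fin (2*m)) F satisfy A * Aᵀ = ((2*m : ℕ) : F) • 1, B * Bᵀ = ((2*m : ℕ) : F) • 1, and A * Bᵀ = 0 (as holds when [A; B] stacked vertically is a Hadamard matrix of size 2m). Then in Matrix (Fin m) (Fin m) (Polynomial F) one has the identity (A.map Polynomial.C + (Polynomial.C i * Polynomial.X) • B.map Polynomial.C) * (Polynomial.C i • (Aᵀ ... Bᵀ).map, precisely: (A.map C + (C i * X) • B.map C) * ((C i) • (Bᵀ.map C) + X • (Aᵀ.map C)) = 0. In other words, (A + iBz)(iBᵀ + Aᵀz) = 0 over the polynomial ring F[z], so iBᵀ + Aᵀz is a control matrix for the convolutional encoder G(z) = A + iBz. -/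
open Matrix Polynomial

theorem hadamard_convolutional_selfDual_control_matrix
    {F : Type*} [Field F] (m : ℕ) (i : F) (hi : i ^ 2 = -1)
    (A B : Matrix (Fin m) (Fin (2 * m)) F)
    (hA : A * Aᵀ = ((2 * m : ℕ) : F) • (1 : Matrix (Fin m) (Fin m) F))
    (hB : B * Bᵀ = ((2 * m : ℕ) : F) • (1 : Matrix (Fin m) (Fin m) F))
    (hAB : A * Bᵀ = 0) :
    (A.map Polynomial.C + (Polynomial.C i * Polynomial.X) • B.map Polynomial.C) *
      ((Polynomial.C i) • (Bᵀ.map Polynomial.C) +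
        (Polynomial.X : Polynomial F) • (Aᵀ.map Polynomial.C)) = 0 := by
  have hBA : B * Aᵀ = 0 := by
    simpa [Matrix.transpose_mul] using congrArg Matrix.transpose hAB
  have hC : (C i * C i : F[X]) = -1 := by
    rw [← C_mul, ← sq, hi, C_neg, C_1]
  have hcoeff : (C i * (C i * X) : F[X]) = -X := by
    linear_combination X * hC
  simp only [Matrix.add_mul, Matrix.mul_add, Matrix.smul_mul, Matrix.mul_smul,
    ← Matrix.map_mul, hA, hB, hAB, hBA, smul_add, smul_smul]
  rw [hcoeff]
  simp
end

section
/- Let F be a field, m a natural number with ((2*m : ℕ) : F) ≠ 0, and i ∈ F with i^2 = -1. Let A, B : Matrix (Fin m) (Fin (2*m)) F satisfy A * Aᵀ = ((2*m : ℕ) : F) • 1 and B * Aᵀ = 0 (as holds when [A; B] stacked vertically is a Hadamard matrix of size 2m). Then the polynomial matrix G = A.map Polynomial.C + (Polynomial.C i * Polynomial.X) • B.map Polynomial.C ∈ Matrix (Fin m) (Fin (2*m)) (Polynomial F) has a right inverse: there exists R : Matrix (Fin (2*m)) (Fin m) (Polynomial F) with G * R = 1. (In particular the convolutional code generated by G(z)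 = A + iBz is non-catastrophic.) -/
open Matrix Polynomial

theorem hadamard_convolutional_encoder_has_right_inverse
    {F : Type*} [Field F] (m : ℕ) (hm : ((2 * m : ℕ) : F) ≠ 0)
    (i : F) (hi : i ^ 2 = -1)
    (A B : Matrix (Fin m) (Fin (2 * m)) F)
    (hA : A * Aᵀ = ((2 * m : ℕ) : F) • (1 : Matrix (Fin m) (Fin m) F))
    (hBA : B * Aᵀ = 0) :
    ∃ R : Matrix (Fin (2 * m)) (Fin m) (Polynomial F),
      (A.map Polynomial.C + (Polynomial.C i * Polynomial.X) • B.map Polynomial.C) * R = 1 := by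
  refine ⟨(((2 * m : ℕ) : F)⁻¹ • Aᵀ).map Polynomial.C, ?_⟩
  rw [Matrix.add_mul, Matrix.smul_mul, ← Matrix.map_mul, ← Matrix.map_mul, Matrix.mul_smul, Matrix.mul_smul, hA, hBA,
    smul_smul, inv_mul_cancel₀ hm, one_smul, smul_zero, Matrix.map_zero _ (map_zero _), smul_zero,
    add_zero, Matrix.map_one _ (map_zero _) (map_one _)]
end

section
/- Let F be a field and i ∈ F with i^2 = -1. Let n = (t + s) + s, let A : Matrix (Fin t ⊕ Fin s) (Fin n) F and B : Matrix (Fin s) (Fin n) F satisfy A * Aᵀ = (n : F) • 1 and A * Bᵀ = 0 and B * Bᵀ = (n : F) • 1 (as holds when [A; B] stacked vertically is a Hadamard matrix of size n, A consisting of r = t + s rows and B of the remaining s = n - r rows, with r > n - r and t = 2r - n). Define B₁ : Matrix (Fin t ⊕ Fin s) (Fin n) F by B₁ (Sum.inl _) = 0 and B₁ (Sum.inr j) = B j, and define C₁ : Matrix (Fin n) (Fin s) F by C₁ k j = A (Sum.inr j) k (the transpose of the last s rows of A). Then in matrices over Polynomial F: (A.map C + (C i * X) • B₁.map C) * ((C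 i) • (Bᵀ.map C) + X • (C₁.map C)) = 0. In other words, (A + iB₁z)(iBᵀ + C₁z) = 0 over F[z], so iBᵀ + C₁z is a control matrix for the convolutional encoder G(z) = A + iB₁z. -/
open Matrix Polynomial

theorem hadamard_convolutional_dualContaining_control_matrix
    {F : Type*} [Field F] (i : F) (hi : i ^ 2 = -1)
    (t s n : ℕ) (hn : n = (t + s) + s)
    (A : Matrix (Fin t ⊕ Fin s) (Fin n) F)
    (B : Matrix (Fin s) (Fin n) F)
    (hA : A * Aᵀ = (n : F) • (1 : Matrix (Fin t ⊕ Fin s) (Fin t ⊕ Fin s) F))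
    (hAB : A * Bᵀ = 0)
    (hB : B * Bᵀ = (n : F) • (1 : Matrix (Fin s) (Fin s) F))
    (B₁ : Matrix (Fin t ⊕ Fin s) (Fin n) F)
    (hB₁l : ∀ j : Fin t, B₁ (Sum.inl j) = 0)
    (hB₁r : ∀ j : Fin s, B₁ (Sum.inr j) = B j)
    (C₁ : Matrix (Fin n) (Fin s) F)
    (hC₁ : ∀ (k : Fin n) (j : Fin s), C₁ k j = A (Sum.inr j) k) :
    (A.map Polynomial.C + (Polynomial.C i * Polynomial.X) • B₁.map Polynomial.C) *
      ((Polynomial.C i) • (Bᵀ.map Polynomial.C) +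
        (Polynomial.X : Polynomial F) • (C₁.map Polynomial.C)) = 0 := by
  have hAC : A * C₁ = B₁ * Bᵀ := by
    ext (a | a) b
    · have h := congrFun₂ hA (Sum.inl a) (Sum.inr b)
      simpa [Matrix.mul_apply, hC₁, hB₁l] using h
    · have h := congrFun₂ hA (Sum.inr a) (Sum.inr b)
      have h' := congrFun₂ hB a b
      simp only [Matrix.mul_apply, Matrix.transpose_apply, Matrix.smul_apply,
        Matrix.one_apply, Sum.inr.injEq] at h h'
      simp only [Matrix.mul_apply, Matrix.transpose_apply, hC₁, hB₁r, h, h']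
  have hBC : B₁ * C₁ = 0 := by
    ext (a | a) b
    · simp [Matrix.mul_apply, hB₁l]
    · have h := congrFun₂ hAB (Sum.inr b) a
      simpa [Matrix.mul_apply, hC₁, hB₁r, mul_comm] using h
  have hi' : (C i * C i : Polynomial F) = -1 := by
    rw [← C_mul, ← sq, hi, C_neg, C_1]
  simp only [Matrix.add_mul, Matrix.mul_add, Matrix.smul_mul, Matrix.mul_smul,
    ← Matrix.map_mul, hAB, hAC, hBC]
  ext1 a b
  simp only [Matrix.add_apply, Matrix.smul_apply, Matrix.map_apply, Matrix.zero_apply,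
    smul_eq_mul, C_0]
  linear_combination X * C ((B₁ * Bᵀ) a b) * hi'
end

section
/- Let F be a field and i ∈ F with i^2 = -1. Let n = a + t + t and let A : Matrix (Fin a) (Fin n) F, B : Matrix (Fin t) (Fin n) F, C : Matrix (Fin t) (Fin n) F satisfy A * Aᵀ = (n : F) • 1, B * Bᵀ = (n : F) • 1, C * Cᵀ = (n : F) • 1, A * Bᵀ = 0, A * Cᵀ = 0 and B * Cᵀ = 0 (as holds when [A; B; C] stacked vertically is a Hadamard matrix of size n with B and C of the same size t × n). Define the polynomial matrix G : Matrix (Fin a ⊕ Fin t) (Fin n) (Polynomial F) by G (Sum.inl j) = (A j).map-row of constants (i.e. row j of A.map Polynomial.C) and G (Sum.inr j) k = Polynomial.C (B j k) + Polynomial.C i * Polynomial.X * Polynomial.C (C j k). Then G * ((Polynomial.C i) • (Cᵀ.map Polynomial.C) + Polynomial.X • (Bᵀ.map Polynomial.C)) = 0. In other words, ([A; B] + i[0; C]z)(iCᵀ + Bᵀz) = 0 over F[z], so iCᵀ + Bᵀz is a control matrix for the convolutional encoder G(z) = [A; B] + i[0; C]z. -/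
open Matrix Polynomial

theorem hadamard_three_block_convolutional_control_matrix
    {F : Type*} [Field F] (i : F) (hi : i ^ 2 = -1)
    (a t n : ℕ) (hn : n = a + t + t)
    (A : Matrix (Fin a) (Fin n) F)
    (B : Matrix (Fin t) (Fin n) F)
    (C : Matrix (Fin t) (Fin n) F)
    (hA : A * Aᵀ = (n : F) • (1 : Matrix (Fin a) (Fin a) F))
    (hB : B * Bᵀ = (n : F) • (1 : Matrix (Fin t) (Fin t) F))
    (hC : C * Cᵀ = (n : F) • (1 : Matrix (Fin t) (Fin t) F))
    (hAB : A * Bᵀ = 0) (hAC : A * Cᵀ = 0) (hBC : B * Cᵀ = 0)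
    (G : Matrix (Fin a ⊕ Fin t) (Fin n) (Polynomial F))
    (hGl : ∀ (j : Fin a) (k : Fin n), G (Sum.inl j) k = Polynomial.C (A j k))
    (hGr : ∀ (j : Fin t) (k : Fin n),
      G (Sum.inr j) k = Polynomial.C (B j k) + Polynomial.C i * Polynomial.X * Polynomial.C (C j k)) :
    G * ((Polynomial.C i) • (Cᵀ.map Polynomial.C) +
        (Polynomial.X : Polynomial F) • (Bᵀ.map Polynomial.C)) = 0 := by
  have hCB : C * Bᵀ = 0 := by
    simpa [Matrix.transpose_mul] using congrArg Matrix.transpose hBC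
  have hG : G = Matrix.fromRows (A.map Polynomial.C)
      (B.map Polynomial.C + (Polynomial.C i * Polynomial.X) • C.map Polynomial.C) := by
    ext1 r k
    rcases r with j | j
    · simp [hGl]
    · simp [hGr]
  have hi' : Polynomial.C i * Polynomial.C i = (-1 : Polynomial F) := by
    rw [← Polynomial.C_mul, ← pow_two, hi, Polynomial.C_neg, Polynomial.C_1]
  have hcoef : Polynomial.C i * (Polynomial.C i * Polynomial.X) = (-Polynomial.X : Polynomial F) := by
    linear_combination Polynomial.X * hi'
  rw [hG, Matrix.fromRows_mul]
  simp only [Matrix.mul_add, Matrix.add_mul, Matrix.mul_smul, Matrix.smul_mul, ← Matrix.map_mul,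
    hAB, hAC, hBC, hCB, hB, hC]
  simp only [Matrix.map_zero _ Polynomial.C_0, smul_zero, add_zero, zero_add, smul_smul, hcoef,
    neg_smul, neg_add_cancel, Matrix.fromRows_zero]
end

section
/- Let n be a natural number, H : Matrix (Fin n) (Fin n) ℤ a Hadamard matrix (all entries 1 or -1 and H * Hᵀ = (n : ℤ) • 1), and let p be a prime with p ≠ 2 and p ∣ n. Then the rank over the field ZMod p of the reduction H.map (Int.cast : ℤ → ZMod p) satisfies 2 * (H.map Int.cast).rank ≤ n. -/
open Matrix

theorem hadamard_rank_le_half_mod_p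
    (n : ℕ) (H : Matrix (Fin n) (Fin n) ℤ)
    (hent : ∀ i j, H i j = 1 ∨ H i j = -1)
    (hHad : H * Hᵀ = (n : ℤ) • (1 : Matrix (Fin n) (Fin n) ℤ))
    (p : ℕ) (hp : p.Prime) (hp2 : p ≠ 2) (hpn : p ∣ n) :
    2 * (H.map (Int.cast : ℤ → ZMod p)).rank ≤ n := by
  have : Fact p.Prime := ⟨hp⟩
  have hmul : H.map (Int.cast : ℤ → ZMod p) * (H.map (Int.cast : ℤ → ZMod p))ᵀ = 0 := by
    have hn : (n : ZMod p) = 0 := (ZMod.natCast_eq_zero_iff n p).2 hpn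
    have h := congrArg (fun M => M.map (Int.castRingHom (ZMod p))) hHad
    rw [Matrix.map_mul, Matrix.transpose_map] at h
    refine h.trans ?_
    ext i j
    rw [Matrix.map_apply, Matrix.smul_apply]
    simp [hn]
  have h := rank_add_rank_le_card_of_mul_eq_zero hmul
  rw [rank_transpose, Fintype.card_fin] at h
  omega
end
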